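/- For every σ ∈ S_η and all f, g ∈ F, one has ∂_{w_η}(f · ∂_σ(g)) = ∂_{w_η}(∂_{σ⁻¹}(f) · g). -/

import Mathlib

open scoped BigOperators

noncomputable section

namespace GTpaper

variable (r : ℕ) (η : Fin r → ℕ)

/-- The index set Σ(η): pairs (k,i) with 1 ≤ k ≤ r, 1 ≤ i ≤ η_k (0-based). -/
abbrev Idx := (k : Fin r) × Fin (η k)

/-- The polynomial ring ℂ[X_η]. -/
abbrev Pol := MvPolynomial (Idx r η) ℂ

/-- The field of rational functions F = ℂ(X_η). -/
abbrev FF := FractionRing (Pol r η)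

/-- The group S_η = S_{η_1} × ⋯ × S_{η_r}. -/
abbrev Sg := ∀ k : Fin r, Equiv.Perm (Fin (η k))

/-- The action of S_η on the index set. -/
def permIdx (σ : Sg r η) : Equiv.Perm (Idx r η) where
  toFun p := ⟨p.1, σ p.1 p.2⟩
  invFun p := ⟨p.1, (σ p.1)⁻¹ p.2⟩
  left_inv p := by simp
  right_inv p := by simp

/-- The action of S_η on ℂ[X_η] by permuting variables. -/
def actP (σ : Sg r η) : Pol r η ≃+* Pol r η :=
  (MvPolynomial.renameEquiv ℂ (permIdx r η σ)).toRingEquiv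

/-- The action of S_η on F = ℂ(X_η) by field automorphisms. -/
def actF (σ : Sg r η) : FF r η ≃+* FF r η :=
  IsFractionRing.ringEquivOfRingEquiv (actP r η σ)

/-- The variable x_{k,i} viewed as an element of F. -/
def XF (p : Idx r η) : FF r η := algebraMap (Pol r η) (FF r η) (MvPolynomial.X p)

/-- The element of S_η which transposes (k,i) and (k,j) and fixes all other indices. -/
def transpT (k : Fin r) (i j : Fin (η k)) : Sg r η :=
  Function.update (1 : Sg r η) k (Equiv.swap i j)

/-- The simple transposition s_i^{(k)}. -/
def simpleT (k : Fin r) (i : ℕ) (h : i + 1 < η k) : Sg r η :=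
  transpT r η k ⟨i, Nat.lt_of_succ_lt h⟩ ⟨i + 1, h⟩

/-- The divided difference operator ∂_i^{(k)} on F. -/
def dd (k : Fin r) (i : ℕ) (h : i + 1 < η k) (f : FF r η) : FF r η :=
  (f - actF r η (simpleT r η k i h) f) /
    (XF r η ⟨k, ⟨i, Nat.lt_of_succ_lt h⟩⟩ - XF r η ⟨k, ⟨i + 1, h⟩⟩)

/-- Data indexing a simple transposition of S_η. -/
abbrev SimpleDat := (k : Fin r) × {i : ℕ // i + 1 < η k}

/-- A word in the simple transpositions of S_η. -/
abbrev Word := List (SimpleDat r η)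

/-- The element of S_η represented by a word. -/
def wordPerm (w : Word r η) : Sg r η :=
  (w.map fun s => simpleT r η s.1 s.2.1 s.2.2).prod

/-- The composite ∂_{j_1} ∘ ⋯ ∘ ∂_{j_l} of divided differences along a word. -/
def ddWord (w : Word r η) (f : FF r η) : FF r η :=
  w.foldr (fun s g => dd r η s.1 s.2.1 s.2.2 g) f

/-- The length ℓ(σ): the total number of inversions of σ. -/
def len (σ : Sg r η) : ℕ :=
  ∑ k : Fin r,
    (Finset.univ.filter fun p : Fin (η k) × Fin (η k) => p.1 < p.2 ∧ σ k p.2 < σ k p.1).card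

/-- `w` is a reduced decomposition of σ. -/
def IsRed (σ : Sg r η) (w : Word r η) : Prop :=
  wordPerm r η w = σ ∧ w.length = len r η σ

/-- The longest word w_η of S_η. -/
def wEta : Sg r η := fun _ => Fin.revPerm

/-- η! = η_1! ⋯ η_r!. -/
def etaFact : ℕ := ∏ k : Fin r, Nat.factorial (η k)

/-- The Vandermonde-type product Δ_η as a polynomial. -/
def DeltaP : Pol r η :=
  ∏ k : Fin r, ∏ p ∈ Finset.univ.filter (fun p : Fin (η k) × Fin (η k) => p.1 < p.2),
    (MvPolynomial.X (⟨k, p.1⟩ : Idx r η) - MvPolynomial.X (⟨k, p.2⟩ : Idx r η))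

/-- Δ_η as an element of F. -/
def DeltaF : FF r η := algebraMap (Pol r η) (FF r η) (DeltaP r η)

/-- The symmetrization operator sym_η on F. -/
def symF (f : FF r η) : FF r η :=
  (etaFact r η : FF r η)⁻¹ * ∑ σ : Sg r η, actF r η σ f

/-- The sign of an element of S_η. -/
def sgn (σ : Sg r η) : ℤ := ∏ k : Fin r, (Equiv.Perm.sign (σ k) : ℤ)

/-- The antisymmetrization operator asym_η on F. -/
def asymF (f : FF r η) : FF r η :=
  (etaFact r η : FF r η)⁻¹ * ∑ σ : Sg r η, (sgn r η σ : FF r η) * actF r η σ f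

/-- The ideal p_η of ℂ[X_η] generated by the differences x_{k,i} - x_{k,j}. -/
def pIdeal : Ideal (Pol r η) :=
  Ideal.span {q | ∃ (k : Fin r) (i j : Fin (η k)), i < j ∧
    q = MvPolynomial.X (⟨k, i⟩ : Idx r η) - MvPolynomial.X (⟨k, j⟩ : Idx r η)}

/-- The number of inversions of a permutation of `Fin n`. -/
def invCount {n : ℕ} (σ : Equiv.Perm (Fin n)) : ℕ :=
  (Finset.univ.filter fun p : Fin n × Fin n => p.1 < p.2 ∧ σ p.2 < σ p.1).card

theorem len_eq_sum_invCount (σ : Sg r η) : len r η σ = ∑ k, invCount (σ k) := rfl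

theorem invCount_inv {n : ℕ} (σ : Equiv.Perm (Fin n)) : invCount σ⁻¹ = invCount σ := by
  unfold invCount
  refine Finset.card_bij' (fun p _ => (σ⁻¹ p.2, σ⁻¹ p.1)) (fun p _ => (σ p.2, σ p.1)) ?_ ?_ ?_ ?_
  all_goals simp +contextual

theorem swap_lt_swap_of_lt {n : ℕ} {x y : Fin n} (hxy : y.val = x.val + 1) {a b : Fin n}
    (hab : a < b) (hne : ¬ (a = x ∧ b = y)) : Equiv.swap x y a < Equiv.swap x y b := by
  simp only [Equiv.swap_apply_def]
  rw [Fin.ext_iff, Fin.ext_iff] at hne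
  rw [Fin.lt_def] at hab ⊢
  simp only [Fin.ext_iff]
  split_ifs <;> omega

theorem invCount_eq_add_one_of_descent {n : ℕ} {x y : Fin n} (hxy : y.val = x.val + 1)
    (σ : Equiv.Perm (Fin n)) (hd : σ y < σ x) :
    invCount σ = invCount (σ * Equiv.swap x y) + 1 := by
  have hlt : x < y := by
    rw [Fin.lt_def]
    omega
  have hmem : (x, y) ∈
      Finset.univ.filter fun p : Fin n × Fin n => p.1 < p.2 ∧ σ p.2 < σ p.1 := by
    simp [hd, hlt]
  unfold invCount
  rw [← Finset.card_erase_add_one hmem]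
  congr 1
  refine Finset.card_bij' (fun p _ => (Equiv.swap x y p.1, Equiv.swap x y p.2))
    (fun p _ => (Equiv.swap x y p.1, Equiv.swap x y p.2)) ?_ ?_ ?_ ?_
  · rintro ⟨a, b⟩ hp
    rw [Finset.mem_erase, Finset.mem_filter] at hp
    rw [Finset.mem_filter]
    refine ⟨Finset.mem_univ _,
      swap_lt_swap_of_lt hxy hp.2.2.1 fun hab => hp.1 (Prod.ext hab.1 hab.2), ?_⟩
    simpa using hp.2.2.2
  · rintro ⟨a, b⟩ hp
    rw [Finset.mem_filter] at hp
    obtain ⟨-, hab, hσ⟩ := hp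
    rw [Finset.mem_erase, Finset.mem_filter]
    refine ⟨fun heq => ?_, Finset.mem_univ _, swap_lt_swap_of_lt hxy hab ?_, hσ⟩
    · obtain ⟨ha, hb⟩ := Prod.ext_iff.1 heq
      have ha' : a = y := by simpa using congrArg (Equiv.swap x y) ha
      have hb' : b = x := by simpa using congrArg (Equiv.swap x y) hb
      subst ha' hb'
      exact hlt.asymm hab
    · rintro ⟨rfl, rfl⟩
      exact hd.asymm (by simpa using hσ)
  · rintro ⟨a, b⟩ _
    simp
  · rintro ⟨a, b⟩ _
    simp

theorem eq_one_of_forall_lt_succ {n : ℕ} (σ : Equiv.Perm (Fin n))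
    (hσ : ∀ (i : ℕ) (h : i + 1 < n), σ ⟨i, Nat.lt_of_succ_lt h⟩ < σ ⟨i + 1, h⟩) : σ = 1 := by
  cases n with
  | zero => exact Subsingleton.elim _ _
  | succ n =>
    have hmono : StrictMono σ := Fin.strictMono_iff_lt_succ.2 fun i => hσ i (by omega)
    ext a
    have := congrArg (fun e : Fin (n + 1) ≃o Fin (n + 1) => (e a : ℕ))
      (Subsingleton.elim (hmono.orderIsoOfSurjective σ σ.surjective) (OrderIso.refl _))
    simpa using this

variable {r η}

theorem len_inv (σ : Sg r η) : len r η σ⁻¹ = len r η σ := by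
  simp only [len_eq_sum_invCount, Pi.inv_apply, invCount_inv]

theorem simpleT_mul_self (k : Fin r) (i : ℕ) (h : i + 1 < η k) :
    simpleT r η k i h * simpleT r η k i h = 1 := by
  funext j
  by_cases hj : j = k
  · subst hj
    simp [simpleT, transpT]
  · simp [simpleT, transpT, Function.update_of_ne hj]

theorem len_eq_add_one_of_descent (σ : Sg r η) (k : Fin r) (i : ℕ) (h : i + 1 < η k)
    (hd : σ k ⟨i + 1, h⟩ < σ k ⟨i, Nat.lt_of_succ_lt h⟩) :
    len r η σ = len r η (σ * simpleT r η k i h) + 1 := by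
  rw [len_eq_sum_invCount, len_eq_sum_invCount, ← Finset.add_sum_erase _ _ (Finset.mem_univ k),
    ← Finset.add_sum_erase _ (fun j => invCount ((σ * simpleT r η k i h) j)) (Finset.mem_univ k),
    invCount_eq_add_one_of_descent rfl _ hd, add_right_comm]
  congr 2
  · simp [simpleT, transpT]
  · refine Finset.sum_congr rfl fun j hj => ?_
    simp [simpleT, transpT, Function.update_of_ne (Finset.ne_of_mem_erase hj)]

theorem IsRed.append_descent {σ : Sg r η} {k : Fin r} {i : ℕ} {h : i + 1 < η k}
    (hd : σ k ⟨i + 1, h⟩ < σ k ⟨i, Nat.lt_of_succ_lt h⟩) {u : Word r η}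
    (hu : IsRed r η (σ * simpleT r η k i h) u) : IsRed r η σ (u ++ [⟨k, i, h⟩]) := by
  refine ⟨?_, ?_⟩
  · have := hu.1
    simp only [wordPerm] at this
    simp [wordPerm, this, mul_assoc, simpleT_mul_self]
  · simp [hu.2, len_eq_add_one_of_descent σ k i h hd]

theorem exists_isRed (σ : Sg r η) : ∃ w, IsRed r η σ w := by
  induction hn : len r η σ generalizing σ with
  | zero =>
    refine ⟨[], ?_, by simp [hn]⟩
    refine (funext fun k => eq_one_of_forall_lt_succ (σ k) fun i h => ?_).symm
    by_contra hlt
    have hne : σ k ⟨i + 1, h⟩ ≠ σ k ⟨i, Nat.lt_of_succ_lt h⟩ := by simp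
    have := len_eq_add_one_of_descent σ k i h (lt_of_le_of_ne (not_lt.1 hlt) hne)
    omega
  | succ n ih =>
    by_cases hσ : ∃ (k : Fin r) (i : ℕ) (h : i + 1 < η k),
        σ k ⟨i + 1, h⟩ < σ k ⟨i, Nat.lt_of_succ_lt h⟩
    · obtain ⟨k, i, h, hd⟩ := hσ
      obtain ⟨u, hu⟩ := ih (σ * simpleT r η k i h) (by
        have := len_eq_add_one_of_descent σ k i h hd
        omega)
      exact ⟨_, hu.append_descent hd⟩
    · push Not at hσ
      have hone : σ = 1 := funext fun k => eq_one_of_forall_lt_succ (σ k) fun i h =>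
        lt_of_le_of_ne (hσ k i h) (by simp)
      subst hone
      have : len r η 1 = 0 := by
        simp only [len, Finset.sum_eq_zero_iff, Finset.card_eq_zero, Finset.filter_eq_empty_iff]
        rintro k - p - ⟨h₁, h₂⟩
        exact h₁.asymm h₂
      omega

theorem IsRed.reverse {σ : Sg r η} {w : Word r η} (hw : IsRed r η σ w) :
    IsRed r η σ⁻¹ w.reverse := by
  refine ⟨?_, by rw [List.length_reverse, hw.2, len_inv]⟩
  rw [← hw.1, wordPerm, wordPerm, List.prod_inv_reverse, List.map_reverse, List.map_map]
  congr 3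
  funext s
  exact eq_inv_of_mul_eq_one_left (simpleT_mul_self _ _ _)

theorem actF_algebraMap (σ : Sg r η) (p : Pol r η) :
    actF r η σ (algebraMap _ _ p) = algebraMap _ _ (actP r η σ p) :=
  IsFractionRing.ringEquivOfRingEquiv_algebraMap _ _

theorem actF_XF (σ : Sg r η) (p : Idx r η) :
    actF r η σ (XF r η p) = XF r η (permIdx r η σ p) := by
  simp [XF, actF_algebraMap, actP]

theorem actF_mul_apply (σ τ : Sg r η) (f : FF r η) :
    actF r η (σ * τ) f = actF r η σ (actF r η τ f) := by
  obtain ⟨a, b, -, rfl⟩ := IsFractionRing.div_surjective (A := Pol r η) f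
  have hP : ∀ p, actP r η (σ * τ) p = actP r η σ (actP r η τ p) := fun p => by
    simp only [actP, AlgEquiv.coe_ringEquiv,
      MvPolynomial.renameEquiv_apply, MvPolynomial.rename_rename]
    rfl
  simp only [map_div₀, actF_algebraMap, hP]

theorem actF_one_apply (f : FF r η) : actF r η 1 f = f :=
  (actF r η 1).injective (by rw [← actF_mul_apply, one_mul])

theorem actF_simpleT_dd (k : Fin r) (i : ℕ) (h : i + 1 < η k) (f : FF r η) :
    actF r η (simpleT r η k i h) (dd r η k i h f) = dd r η k i h f := by
  simp only [dd, map_div₀, map_sub, ← actF_mul_apply, simpleT_mul_self, actF_one_apply, actF_XF]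
  rw [← neg_div_neg_eq, neg_sub, neg_sub]
  simp [permIdx, simpleT, transpT]

theorem dd_mul_of_invariant (k : Fin r) (i : ℕ) (h : i + 1 < η k) {a : FF r η}
    (ha : actF r η (simpleT r η k i h) a = a) (g : FF r η) :
    dd r η k i h (a * g) = a * dd r η k i h g := by
  simp only [dd, map_mul, ha]
  rw [← mul_sub, mul_div_assoc]

theorem dd_mul_dd (k : Fin r) (i : ℕ) (h : i + 1 < η k) (f g : FF r η) :
    dd r η k i h (f * dd r η k i h g) = dd r η k i h (dd r η k i h f * g) := by
  rw [mul_comm f, dd_mul_of_invariant k i h (actF_simpleT_dd k i h g),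
    dd_mul_of_invariant k i h (actF_simpleT_dd k i h f), mul_comm]

theorem ddWord_append_singleton (u : Word r η) (s : SimpleDat r η) (f : FF r η) :
    ddWord r η (u ++ [s]) f = ddWord r η u (dd r η s.1 s.2.1 s.2.2 f) := by
  simp [ddWord]

/-- The longest element has a reduced word ending in any given simple transposition. -/
theorem exists_isRed_wEta_append (s : SimpleDat r η) :
    ∃ u, IsRed r η (wEta r η) (u ++ [s]) := by
  obtain ⟨u, hu⟩ := exists_isRed (wEta r η * simpleT r η s.1 s.2.1 s.2.2)
  exact ⟨u, hu.append_descent (by simp [wEta])⟩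

variable (r η)

/-- ∂_{w_η}(f·∂_σ(g)) = ∂_{w_η}(∂_{σ⁻¹}(f)·g).  Here `Pd` is the family of
divided difference operators ∂_σ, characterized by its values along reduced words. -/
theorem statement5 (m r : ℕ) (η : Fin r → ℕ) (hpos : ∀ k, 0 < η k) (hsum : ∑ k, η k = m)
    (Pd : Sg r η → FF r η → FF r η)
    (hPd : ∀ (σ : Sg r η) (w : Word r η), IsRed r η σ w → ∀ f, Pd σ f = ddWord r η w f) :
    ∀ (σ : Sg r η) (f g : FF r η),
      Pd (wEta r η) (f * Pd σ g) = Pd (wEta r η) (Pd σ⁻¹ f * g) := by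
  have key : ∀ (v : Word r η) (f g : FF r η),
      Pd (wEta r η) (f * ddWord r η v g) = Pd (wEta r η) (ddWord r η v.reverse f * g) := by
    intro v
    induction v with
    | nil => intro f g; rfl
    | cons s v ih =>
      intro f g
      obtain ⟨u, hu⟩ := exists_isRed_wEta_append s
      rw [List.reverse_cons, ddWord_append_singleton, ← ih, hPd _ _ hu, hPd _ _ hu,
        ddWord_append_singleton, ddWord_append_singleton, ← dd_mul_dd]
      rfl
  intro σ f g
  obtain ⟨w, hw⟩ := exists_isRed σ
  rw [hPd σ w hw, hPd σ⁻¹ w.reverse hw.reverse, key]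
end GTpaper

end
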